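/- There exists a D-avoiding 4-cycle system of order v for all v ≡ 1 (mod 8). -/

import Mathlib

open Finset

/-- The edge set of the 4-cycle `(a, b, c, d)`: edges {a,b}, {b,c}, {c,d}, {d,a}. -/
def cycEdges {V : Type*} [DecidableEq V] (a b c d : V) : Finset (Sym2 V) :=
  {s(a, b), s(b, c), s(c, d), s(d, a)}

/-- `E` is the edge set of a 4-cycle on four distinct vertices. -/
def IsFourCycle {V : Type*} [DecidableEq V] (E : Finset (Sym2 V)) : Prop :=
  ∃ a b c d : V, ([a, b, c, d] : List V).Nodup ∧ E = cycEdges a b c d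

/-- The set of vertices covered by a set of edges. -/
def edgeVerts {V : Type*} [DecidableEq V] (E : Finset (Sym2 V)) : Finset V :=
  E.sup (Sym2.lift ⟨fun x y => ({x, y} : Finset V), fun x y => Finset.pair_comm x y⟩)

/-- A `(k, l)`-configuration: a set of `l` pairwise edge-disjoint 4-cycles whose
union contains exactly `k` vertices. -/
def IsConfiguration {V : Type*} [DecidableEq V] (k l : ℕ)
    (D : Finset (Finset (Sym2 V))) : Prop :=
  D.card = l ∧ (∀ E ∈ D, IsFourCycle E) ∧
    (∀ E ∈ D, ∀ F ∈ D, E ≠ F → Disjoint E F) ∧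
    (D.sup edgeVerts).card = k

/-- `C` is a 4-cycle system: a collection of 4-cycles whose edge sets partition
the edge set of the complete graph on `V`. -/
def IsFourCycleSystem {V : Type*} [DecidableEq V] (C : Finset (Finset (Sym2 V))) : Prop :=
  (∀ E ∈ C, IsFourCycle E) ∧ ∀ e : Sym2 V, ¬ e.IsDiag → ∃! E, E ∈ C ∧ e ∈ E

/-- `C` is a 4-cycle packing: a set of pairwise edge-disjoint 4-cycles. -/
def IsFourCyclePacking {V : Type*} [DecidableEq V] (C : Finset (Finset (Sym2 V))) : Prop :=
  (∀ E ∈ C, IsFourCycle E) ∧ ∀ E ∈ C, ∀ F ∈ C, E ≠ F → Disjoint E F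

/-- `C` is `r`-sparse: it contains no `(j+3, j)`-configuration for `2 ≤ j ≤ r`. -/
def RSparse {V : Type*} [DecidableEq V] (r : ℕ) (C : Finset (Finset (Sym2 V))) : Prop :=
  ∀ j, 2 ≤ j → j ≤ r → ∀ D ⊆ C, ¬ IsConfiguration (j + 3) j D

/-- Two 4-cycles form a double-diamond: they are `(a,b,c,d)` and `(a,e,c,f)`,
sharing the diagonal {a,c}. -/
def IsDoubleDiamond {V : Type*} [DecidableEq V] (E F : Finset (Sym2 V)) : Prop :=
  ∃ a b c d e f : V, ([a, b, c, d, e, f] : List V).Nodup ∧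
    E = cycEdges a b c d ∧ F = cycEdges a e c f

/-- `C` is D-avoiding: no two of its 4-cycles form a double-diamond. -/
def DAvoiding {V : Type*} [DecidableEq V] (C : Finset (Finset (Sym2 V))) : Prop :=
  ∀ E ∈ C, ∀ F ∈ C, ¬ IsDoubleDiamond E F

/-- `C` is strictly `r`-sparse: `r`-sparse and D-avoiding. -/
def StrictlyRSparse {V : Type*} [DecidableEq V] (r : ℕ)
    (C : Finset (Finset (Sym2 V))) : Prop :=
  RSparse r C ∧ DAvoiding C

/-- A family of `n` base 4-cycles for a cyclic system over `ZMod (8 * n + 1)`: the signed edge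
differences of base cycle `i` are `S i 0, …, S i 3`; its diagonals are `S i 0 + S i 1` and
`S i 1 + S i 2`. -/
structure BaseFam (n : ℕ) where
  a : ℕ → ℤ
  b : ℕ → ℤ
  c : ℕ → ℤ
  d : ℕ → ℤ
  hsum : ∀ i < n, a i + b i + c i + d i = 0
  hS : ∀ i < n, ∀ k : Fin 4, (![a i, b i, c i, d i] k) ≠ 0 ∧
    -(4 * n : ℤ) ≤ ![a i, b i, c i, d i] k ∧ ![a i, b i, c i, d i] k ≤ 4 * n
  hSinj : ∀ i < n, ∀ j < n, ∀ k l : Fin 4,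
    (![a i, b i, c i, d i] k = ![a j, b j, c j, d j] l ∨
      ![a i, b i, c i, d i] k = - ![a j, b j, c j, d j] l) → i = j ∧ k = l
  hT : ∀ i < n, ∀ k : Fin 2, (![a i + b i, b i + c i] k) ≠ 0 ∧
    -(8 * n : ℤ) ≤ ![a i + b i, b i + c i] k ∧ ![a i + b i, b i + c i] k ≤ 8 * n
  hTinj : ∀ i < n, ∀ j < n, ∀ k l : Fin 2, ∀ z : ℤ,
    (z = ![a i + b i, b i + c i] k - ![a j + b j, b j + c j] l ∨
     z = ![a i + b i, b i + c i] k + ![a j + b j, b j + c j] l) →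
    (z = 0 ∨ z = 8 * n + 1 ∨ z = -(8 * n + 1)) → i = j ∧ k = l

theorem small_of_cast {n : ℕ} {z : ℤ} (h : (z : ZMod (8 * n + 1)) = 0)
    (h1 : -(16 * n + 1 : ℤ) ≤ z) (h2 : z ≤ 16 * n + 1) :
    z = 0 ∨ z = 8 * n + 1 ∨ z = -(8 * n + 1) := by
  rw [ZMod.intCast_zmod_eq_zero_iff_dvd] at h
  obtain ⟨k, hk⟩ := h
  push_cast at hk
  have hn : (0 : ℤ) ≤ n := Int.natCast_nonneg n
  have k1 : k < 2 := by by_contra hc; nlinarith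
  have k2 : -2 < k := by by_contra hc; nlinarith
  have : k = -1 ∨ k = 0 ∨ k = 1 := by omega
  rcases this with rfl | rfl | rfl
  · right; right; linarith
  · left; linarith
  · right; left; linarith

theorem diag_aux {V : Type*} [DecidableEq V] {u w p q r t : V} (huw : u ≠ w)
    (hu : u = p ∨ u = q ∨ u = r ∨ u = t) (hw : w = p ∨ w = q ∨ w = r ∨ w = t)
    (h : s(u, w) ∉ cycEdges p q r t) : s(p, r) = s(u, w) ∨ s(q, t) = s(u, w) := by
  simp only [cycEdges, Finset.mem_insert, Finset.mem_singleton, Sym2.eq_iff] at h ⊢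
  rcases hu with rfl | rfl | rfl | rfl <;> rcases hw with rfl | rfl | rfl | rfl <;> simp_all

namespace BaseFam
variable {n : ℕ} (B : BaseFam n)

/-- signed edge differences -/
def S (i : ℕ) (k : Fin 4) : ℤ := ![B.a i, B.b i, B.c i, B.d i] k
/-- signed diagonal differences -/
def T (i : ℕ) (k : Fin 2) : ℤ := ![B.a i + B.b i, B.b i + B.c i] k
/-- partial sums (start of `k`-th edge) -/
def P (i : ℕ) (k : Fin 4) : ℤ := ![0, B.a i, B.a i + B.b i, B.a i + B.b i + B.c i] k
/-- start of `k`-th diagonal -/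
def Q (i : ℕ) (k : Fin 2) : ℤ := ![0, B.a i] k

theorem S_cast_ne {i : ℕ} (hi : i < n) (k : Fin 4) : (B.S i k : ZMod (8 * n + 1)) ≠ 0 := by
  intro h
  have := B.hS i hi k
  rcases small_of_cast h (by unfold S; omega) (by unfold S; omega) with h | h | h <;>
    unfold S at h <;> omega

theorem T_cast_ne {i : ℕ} (hi : i < n) (k : Fin 2) : (B.T i k : ZMod (8 * n + 1)) ≠ 0 := by
  intro h
  have := B.hT i hi k
  rcases small_of_cast h (by unfold T; omega) (by unfold T; omega) with h | h | h <;>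
    unfold T at h <;> omega

theorem two_ne {n : ℕ} {z : ZMod (8 * n + 1)} (hz : z ≠ 0) : z ≠ -z := by
  intro h
  apply hz
  have h2 : z + z = 0 := by nth_rewrite 1 [h]; ring
  have hv : ((8 * n + 1 : ℕ) : ZMod (8 * n + 1)) = 0 := ZMod.natCast_self _
  push_cast at hv
  linear_combination z * hv - 4 * (n : ZMod (8 * n + 1)) * h2

theorem S_inj {i j : ℕ} (hi : i < n) (hj : j < n) (k l : Fin 4)
    (h : (B.S i k : ZMod (8 * n + 1)) = B.S j l ∨ (B.S i k : ZMod (8 * n + 1)) = - B.S j l) :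
    i = j ∧ k = l := by
  have h1 := B.hS i hi k
  have h2 := B.hS j hj l
  apply B.hSinj i hi j hj k l
  rcases h with h | h
  · left
    have h0 : ((B.S i k - B.S j l : ℤ) : ZMod (8 * n + 1)) = 0 := by push_cast; rw [h]; ring
    rcases small_of_cast h0 (by unfold S; omega) (by unfold S; omega) with h | h | h <;>
      unfold S at h <;> omega
  · right
    have h0 : ((B.S i k + B.S j l : ℤ) : ZMod (8 * n + 1)) = 0 := by push_cast; rw [h]; ring
    rcases small_of_cast h0 (by unfold S; omega) (by unfold S; omega) with h | h | h <;>
      unfold S at h <;> omega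

theorem T_inj {i j : ℕ} (hi : i < n) (hj : j < n) (k l : Fin 2)
    (h : (B.T i k : ZMod (8 * n + 1)) = B.T j l ∨ (B.T i k : ZMod (8 * n + 1)) = - B.T j l) :
    i = j ∧ k = l := by
  have h1 := B.hT i hi k
  have h2 := B.hT j hj l
  rcases h with h | h
  · have h0 : ((B.T i k - B.T j l : ℤ) : ZMod (8 * n + 1)) = 0 := by push_cast; rw [h]; ring
    have h3 := small_of_cast h0 (by unfold T; omega) (by unfold T; omega)
    exact B.hTinj i hi j hj k l _ (Or.inl rfl) h3
  · have h0 : ((B.T i k + B.T j l : ℤ) : ZMod (8 * n + 1)) = 0 := by push_cast; rw [h]; ring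
    have h3 := small_of_cast h0 (by unfold T; omega) (by unfold T; omega)
    exact B.hTinj i hi j hj k l _ (Or.inr rfl) h3

/-- every nonzero residue is plus or minus an edge difference -/
theorem S_surj (z : ZMod (8 * n + 1)) (hz : z ≠ 0) :
    ∃ i < n, ∃ k, z = B.S i k ∨ z = - B.S i k := by
  classical
  have hinj : Set.InjOn (fun p : ℕ × Fin 4 => (B.S p.1 p.2).natAbs)
      ((Finset.range n ×ˢ (Finset.univ : Finset (Fin 4)) : Finset (ℕ × Fin 4)) : Set _) := by
    rintro ⟨i, k⟩ hi ⟨j, l⟩ hj h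
    simp at hi hj h
    have := B.hSinj i hi j hj k l (by unfold S at h; omega)
    simp [this.1, this.2]
  have hcard := Finset.card_image_of_injOn hinj
  have hsub : Finset.image (fun p : ℕ × Fin 4 => (B.S p.1 p.2).natAbs)
      (Finset.range n ×ˢ (Finset.univ : Finset (Fin 4))) ⊆ Finset.Icc 1 (4 * n) := by
    intro x hx
    simp only [Finset.mem_image, Finset.mem_product, Finset.mem_range, Prod.exists] at hx
    obtain ⟨i, k, ⟨hi, -⟩, rfl⟩ := hx
    have := B.hS i hi k
    rw [Finset.mem_Icc]
    unfold S
    omega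
  have heq := Finset.eq_of_subset_of_card_le hsub (by
    rw [hcard]; simp; omega)
  have hmem : z.valMinAbs.natAbs ∈ Finset.Icc 1 (4 * n) := by
    rw [Finset.mem_Icc]
    have h1 := ZMod.natAbs_valMinAbs_le z
    have h2 : z.valMinAbs ≠ 0 := by simpa using hz
    omega
  rw [← heq] at hmem
  simp only [Finset.mem_image, Finset.mem_product, Finset.mem_range, Prod.exists] at hmem
  obtain ⟨i, k, ⟨hi, -⟩, h⟩ := hmem
  refine ⟨i, hi, k, ?_⟩
  have hz' := ZMod.coe_valMinAbs z
  have : z.valMinAbs = B.S i k ∨ z.valMinAbs = - B.S i k := by omega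
  rcases this with h | h
  · left; rw [← hz', h]
  · right; rw [← hz', h]; push_cast; rfl

section cyc
variable [DecidableEq (ZMod (8 * n + 1))]

/-- the translate by `x` of base cycle `i` -/
def cyc (x : ZMod (8 * n + 1)) (i : ℕ) : Finset (Sym2 (ZMod (8 * n + 1))) :=
  cycEdges (x + B.P i 0) (x + B.P i 1) (x + B.P i 2) (x + B.P i 3)

theorem mem_cyc {x : ZMod (8 * n + 1)} {i : ℕ} (hi : i < n) (e : Sym2 (ZMod (8 * n + 1))) :
    e ∈ B.cyc x i ↔ ∃ k, e = s(x + B.P i k, x + B.P i k + B.S i k) := by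
  have h0 : (B.d i : ZMod (8 * n + 1)) = - (B.a i + B.b i + B.c i) := by
    have := congrArg (Int.cast : ℤ → ZMod (8 * n + 1)) (B.hsum i hi)
    push_cast at this
    linear_combination this
  simp [cyc, cycEdges, Fin.exists_fin_succ, P, S, h0, add_assoc]

theorem nodup {i : ℕ} (hi : i < n) (x : ZMod (8 * n + 1)) :
    [x + (B.P i 0 : ZMod (8 * n + 1)), x + B.P i 1, x + B.P i 2, x + B.P i 3].Nodup := by
  have h0 : (B.d i : ZMod (8 * n + 1)) = - (B.a i + B.b i + B.c i) := by
    have := congrArg (Int.cast : ℤ → ZMod (8 * n + 1)) (B.hsum i hi)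
    push_cast at this
    linear_combination this
  have s0 := B.S_cast_ne hi 0
  have s1 := B.S_cast_ne hi 1
  have s2 := B.S_cast_ne hi 2
  have s3 := B.S_cast_ne hi 3
  have t0 := B.T_cast_ne hi 0
  have t1 := B.T_cast_ne hi 1
  simp [S, T, h0] at s0 s1 s2 s3 t0 t1
  simp [P]
  refine ⟨⟨s0, t0, fun h => s3 ?_⟩, ⟨s1, fun h => t1 ?_⟩, s2⟩
  · linear_combination -h
  · linear_combination -h

theorem diag {i : ℕ} (x u w : ZMod (8 * n + 1)) (huw : u ≠ w)
    (hu : ∃ k, u = x + B.P i k) (hw : ∃ k, w = x + B.P i k) (hnot : s(u, w) ∉ B.cyc x i) :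
    ∃ k, s(u, w) = s(x + (B.Q i k : ZMod (8 * n + 1)), x + B.Q i k + B.T i k) := by
  obtain ⟨k, hk⟩ := hu
  obtain ⟨l, hl⟩ := hw
  have e02 : x + (B.P i 2 : ZMod (8 * n + 1)) = x + B.Q i 0 + B.T i 0 := by
    simp [P, Q, T]
  have e13 : x + (B.P i 3 : ZMod (8 * n + 1)) = x + B.Q i 1 + B.T i 1 := by
    simp [P, Q, T]; ring
  have q0 : B.P i 0 = B.Q i 0 := rfl
  have q1 : B.P i 1 = B.Q i 1 := rfl
  have key : ∀ e, s(x + (B.P i 0 : ZMod (8 * n + 1)), x + B.P i 2) = e ∨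
      s(x + (B.P i 1 : ZMod (8 * n + 1)), x + B.P i 3) = e →
      ∃ k, e = s(x + (B.Q i k : ZMod (8 * n + 1)), x + B.Q i k + B.T i k) := by
    rintro e (rfl | rfl)
    · exact ⟨0, by rw [e02, q0]⟩
    · exact ⟨1, by rw [e13, q1]⟩
  apply key
  exact diag_aux huw
    (by fin_cases k <;> [left; (right; left); (right; right; left); (right; right; right)] <;>
      exact hk)
    (by fin_cases l <;> [left; (right; left); (right; right; left); (right; right; right)] <;>
      exact hl) hnot

theorem edge_inj {x y : ZMod (8 * n + 1)} {i j : ℕ} (hi : i < n) (hj : j < n) {k l : Fin 4}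
    (h : s(x + (B.P i k : ZMod (8 * n + 1)), x + B.P i k + B.S i k) =
      s(y + (B.P j l : ZMod (8 * n + 1)), y + B.P j l + B.S j l)) : x = y ∧ i = j := by
  rw [Sym2.eq_iff] at h
  rcases h with ⟨h1, h2⟩ | ⟨h1, h2⟩
  · have hs : (B.S i k : ZMod (8 * n + 1)) = B.S j l := by linear_combination h2 - h1
    obtain ⟨rfl, rfl⟩ := B.S_inj hi hj k l (Or.inl hs)
    exact ⟨add_right_cancel h1, rfl⟩
  · have hs : (B.S i k : ZMod (8 * n + 1)) = - B.S j l := by linear_combination h2 - h1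
    obtain ⟨rfl, rfl⟩ := B.S_inj hi hj k l (Or.inr hs)
    exact absurd hs (two_ne (B.S_cast_ne hi k))

theorem diag_inj {x y : ZMod (8 * n + 1)} {i j : ℕ} (hi : i < n) (hj : j < n) {k l : Fin 2}
    (h : s(x + (B.Q i k : ZMod (8 * n + 1)), x + B.Q i k + B.T i k) =
      s(y + (B.Q j l : ZMod (8 * n + 1)), y + B.Q j l + B.T j l)) : x = y ∧ i = j := by
  rw [Sym2.eq_iff] at h
  rcases h with ⟨h1, h2⟩ | ⟨h1, h2⟩
  · have hs : (B.T i k : ZMod (8 * n + 1)) = B.T j l := by linear_combination h2 - h1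
    obtain ⟨rfl, rfl⟩ := B.T_inj hi hj k l (Or.inl hs)
    exact ⟨add_right_cancel h1, rfl⟩
  · have hs : (B.T i k : ZMod (8 * n + 1)) = - B.T j l := by linear_combination h2 - h1
    obtain ⟨rfl, rfl⟩ := B.T_inj hi hj k l (Or.inr hs)
    exact absurd hs (two_ne (B.T_cast_ne hi k))

theorem vert_of_edge {x u w : ZMod (8 * n + 1)} {i : ℕ} (h : s(u, w) ∈ B.cyc x i) :
    ∃ k, u = x + B.P i k := by
  simp only [cyc, cycEdges, Finset.mem_insert, Finset.mem_singleton, Sym2.eq_iff] at h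
  rcases h with (⟨h, -⟩ | ⟨h, -⟩) | (⟨h, -⟩ | ⟨h, -⟩) | (⟨h, -⟩ | ⟨h, -⟩) | (⟨h, -⟩ | ⟨h, -⟩) <;>
    exact ⟨_, h⟩

end cyc

theorem exists_system (B : BaseFam n) [DecidableEq (ZMod (8 * n + 1))] : ∃ C : Finset (Finset (Sym2 (ZMod (8 * n + 1)))),
    IsFourCycleSystem C ∧ DAvoiding C := by
  classical
  let C := Finset.image (fun p : ZMod (8 * n + 1) × ℕ => B.cyc p.1 p.2)
    (Finset.univ ×ˢ Finset.range n)
  have hC : ∀ E, E ∈ C ↔ ∃ x, ∃ i < n, E = B.cyc x i := by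
    intro E
    simp only [C, Finset.mem_image, Finset.mem_product, Finset.mem_univ, true_and,
      Finset.mem_range, Prod.exists]
    constructor
    · rintro ⟨x, i, hi, rfl⟩; exact ⟨x, i, hi, rfl⟩
    · rintro ⟨x, i, hi, rfl⟩; exact ⟨x, i, hi, rfl⟩
  refine ⟨C, ⟨?_, ?_⟩, ?_⟩
  · intro E hE
    obtain ⟨x, i, hi, rfl⟩ := (hC E).1 hE
    exact ⟨_, _, _, _, B.nodup hi x, rfl⟩
  · intro e he
    have hex : ∃ x, ∃ i < n, e ∈ B.cyc x i := by
      induction e using Sym2.inductionOn with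
      | hf u w =>
        rw [Sym2.mk_isDiag_iff] at he
        obtain ⟨i, hi, k, h⟩ := B.S_surj (w - u) (sub_ne_zero.2 (Ne.symm he))
        rcases h with h | h
        · refine ⟨u - B.P i k, i, hi, (B.mem_cyc hi _).2 ⟨k, ?_⟩⟩
          rw [← h]; simp
        · refine ⟨w - B.P i k, i, hi, (B.mem_cyc hi _).2 ⟨k, ?_⟩⟩
          have : (B.S i k : ZMod (8 * n + 1)) = u - w := by linear_combination h
          rw [this, Sym2.eq_swap]; simp
    obtain ⟨x, i, hi, hx⟩ := hex
    refine ⟨B.cyc x i, ⟨(hC _).2 ⟨x, i, hi, rfl⟩, hx⟩, ?_⟩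
    rintro F ⟨hF, heF⟩
    obtain ⟨y, j, hj, rfl⟩ := (hC F).1 hF
    obtain ⟨k, hk⟩ := (B.mem_cyc hi e).1 hx
    obtain ⟨l, hl⟩ := (B.mem_cyc hj e).1 heF
    obtain ⟨rfl, rfl⟩ := B.edge_inj hi hj (hk.symm.trans hl)
    rfl
  · intro E hE F hF hD
    obtain ⟨x, i, hi, hEx⟩ := (hC E).1 hE
    obtain ⟨y, j, hj, hFy⟩ := (hC F).1 hF
    obtain ⟨a, b, c, d, e, f, hnd, h1, h2⟩ := hD
    simp only [List.nodup_cons, List.mem_cons, List.not_mem_nil, or_false, not_or] at hnd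
    obtain ⟨⟨hab, hac, had, hae, haf⟩, ⟨hbc, hbd, hbe, hbf⟩, ⟨hcd, hce, hcf⟩, -⟩ := hnd
    have key : ∀ {G : Finset (Sym2 (ZMod (8 * n + 1)))} {z : ZMod (8 * n + 1)} {i : ℕ}
        {p q : ZMod (8 * n + 1)}, G = B.cyc z i → G = cycEdges a p c q → a ≠ p → a ≠ q →
        c ≠ p → c ≠ q →
        ∃ k, s(a, c) = s(z + (B.Q i k : ZMod (8 * n + 1)), z + B.Q i k + B.T i k) := by
      intro G z i p q hG hG' ap aq cp cq
      apply B.diag z a c hac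
      · apply B.vert_of_edge (w := p)
        rw [← hG, hG']; simp [cycEdges]
      · apply B.vert_of_edge (w := q)
        rw [← hG, hG']; simp [cycEdges]
      · rw [← hG, hG']
        simp only [cycEdges, Finset.mem_insert, Finset.mem_singleton, Sym2.eq_iff]
        have := Ne.symm hac
        tauto
    obtain ⟨k, hk⟩ := key hEx h1 hab had (Ne.symm hbc) hcd
    obtain ⟨l, hl⟩ := key hFy h2 hae haf hce hcf
    obtain ⟨rfl, rfl⟩ := B.diag_inj hi hj (hk.symm.trans hl)
    have hm : s(a, b) ∈ F := by
      rw [hFy, ← hEx, h1]; simp [cycEdges]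
    rw [h2] at hm
    simp only [cycEdges, Finset.mem_insert, Finset.mem_singleton, Sym2.eq_iff] at hm
    tauto
end BaseFam

set_option maxHeartbeats 4000000

/-- even `n = 2t`, `t % 3 ≠ 2` -/
def famE1 (t : ℕ) (ht : t % 3 ≠ 2) : BaseFam (2 * t) where
  a i := if i < t then i + 1 else (i - t) + (3 * t + 1)
  b i := if i < t then 2 * i + t + 1 else 2 * (i - t) - 3 * t
  c i := if i < t then - i - (7 * t + 1) else - (i - t) - (6 * t + 1)
  d i := if i < t then - (2 * i) + 6 * t - 1 else - (2 * (i - t)) + 6 * t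
  hsum i hi := by
    split_ifs <;> ring
  hS i hi k := by
    fin_cases k <;> simp <;> split_ifs <;> omega
  hSinj i hi j hj k l h := by
    fin_cases k <;> fin_cases l <;> simp at h ⊢ <;> split_ifs at h <;> omega
  hT i hi k := by
    fin_cases k <;> simp <;> split_ifs <;> omega
  hTinj i hi j hj k l z h h' := by
    fin_cases k <;> fin_cases l <;> simp at h h' ⊢ <;> split_ifs at h <;> omega

/-- even `n = 2t`, `t % 3 ≠ 0` -/
def famE2 (t : ℕ) (ht : t % 3 ≠ 0) : BaseFam (2 * t) where
  a i := if i + 1 < t then i + 1 else if i + 1 = t then t + 1 else (i - t) + (3 * t + 1)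
  b i := if i + 1 < t then 2 * i + t + 3 else if i + 1 = t then t else 2 * (i - t) - 3 * t
  c i := if i + 1 < t then - i - (7 * t + 1) else if i + 1 = t then 6 * t - 1
    else - (i - t) - (6 * t + 1)
  d i := if i + 1 < t then - (2 * i) + 6 * t - 3 else if i + 1 = t then - (8 * t)
    else - (2 * (i - t)) + 6 * t
  hsum i hi := by
    split_ifs <;> ring
  hS i hi k := by
    fin_cases k <;> simp <;> split_ifs <;> omega
  hSinj i hi j hj k l h := by
    fin_cases k <;> fin_cases l <;> simp at h ⊢ <;> split_ifs at h <;> omega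
  hT i hi k := by
    fin_cases k <;> simp <;> split_ifs <;> omega
  hTinj i hi j hj k l z h h' := by
    fin_cases k <;> fin_cases l <;> simp at h h' ⊢ <;> split_ifs at h <;> omega

/-- odd `n = 2p + 1`, `p % 3 ≠ 1` -/
def famO1 (p : ℕ) (hp : p % 3 ≠ 1) : BaseFam (2 * p + 1) where
  a i := if i < p then i + 1 else (i - p) + (3 * p + 2)
  b i := if i < p then 2 * i + p + 2 else 2 * (i - p) - 3 * p - 1
  c i := if i < p then - i - (7 * p + 5) else - (i - p) - (6 * p + 4)
  d i := if i < p then - (2 * i) + 6 * p + 2 else - (2 * (i - p)) + 6 * p + 3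
  hsum i hi := by
    split_ifs <;> ring
  hS i hi k := by
    fin_cases k <;> simp <;> split_ifs <;> omega
  hSinj i hi j hj k l h := by
    fin_cases k <;> fin_cases l <;> simp at h ⊢ <;> split_ifs at h <;> omega
  hT i hi k := by
    fin_cases k <;> simp <;> split_ifs <;> omega
  hTinj i hi j hj k l z h h' := by
    fin_cases k <;> fin_cases l <;> simp at h h' ⊢ <;> split_ifs at h <;> omega

/-- odd `n = 2p + 1`, `p % 3 ≠ 2` -/
def famO2 (p : ℕ) (hp : p % 3 ≠ 2) : BaseFam (2 * p + 1) where
  a i := if i < p then i + 1 else (i - p) + (6 * p + 4)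
  b i := if i < p then 2 * i + 4 * p + 4 else 2 * (i - p) + p + 1
  c i := if i < p then - i - (7 * p + 5) else - (i - p) - (3 * p + 2)
  d i := if i < p then - (2 * i) + 3 * p else - (2 * (i - p)) - (4 * p + 3)
  hsum i hi := by
    split_ifs <;> ring
  hS i hi k := by
    fin_cases k <;> simp <;> split_ifs <;> omega
  hSinj i hi j hj k l h := by
    fin_cases k <;> fin_cases l <;> simp at h ⊢ <;> split_ifs at h <;> omega
  hT i hi k := by
    fin_cases k <;> simp <;> split_ifs <;> omega
  hTinj i hi j hj k l z h h' := by
    fin_cases k <;> fin_cases l <;> simp at h h' ⊢ <;> split_ifs at h <;> omega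

theorem nonempty_baseFam (n : ℕ) : Nonempty (BaseFam n) := by
  rcases Nat.even_or_odd' n with ⟨t, rfl | rfl⟩
  · by_cases h : t % 3 = 2
    · exact ⟨famE2 t (by omega)⟩
    · exact ⟨famE1 t h⟩
  · by_cases h : t % 3 = 1
    · exact ⟨famO2 t (by omega)⟩
    · exact ⟨famO1 t h⟩

/-- There exists a D-avoiding 4-cycle system of order `v` for all `v ≡ 1 (mod 8)`. -/
theorem exists_D_avoiding_fourCycleSystem (v : ℕ) (hv : v % 8 = 1) :
    ∃ C : Finset (Finset (Sym2 (Fin v))), IsFourCycleSystem C ∧ DAvoiding C := by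
  obtain ⟨n, rfl⟩ : ∃ n, v = 8 * n + 1 := ⟨v / 8, by omega⟩
  obtain ⟨B⟩ := nonempty_baseFam n
  exact @BaseFam.exists_system n B (inferInstanceAs (DecidableEq (Fin (8 * n + 1))))
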